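/- For every odd integer m ≥ 3 and every ε > 0 there exists n₀ ∈ ℕ such that for all n ≥ n₀, the number of independent sets in the discrete torus Z_m^n satisfies |II(Z_m^n)| ≥ 2^(⌊m/2⌋·m^(n−1)) · exp((1 − ε)·(m/2)^(n−1)). -/

import Mathlib

/-- The discrete torus `Z_m^n`: the graph on `(ZMod m)^n` where two vertices are adjacent
iff they differ by `±1 (mod m)` in exactly one coordinate. -/
def torus (m n : ℕ) : SimpleGraph (Fin n → ZMod m) :=
  SimpleGraph.fromRel fun u v =>
    ∃ j : Fin n, (u j = v j + 1 ∨ u j = v j - 1) ∧ ∀ i : Fin n, i ≠ j → u i = v i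

/-- A set of vertices is independent if its vertices are pairwise non-adjacent. -/
def IsIndep {V : Type*} (G : SimpleGraph V) (s : Set V) : Prop :=
  s.Pairwise fun u v => ¬ G.Adj u v

/-- `N_G(X) := (⋃ x ∈ X, N_G(x)) \ X`. -/
def nbhd {V : Type*} (G : SimpleGraph V) (X : Set V) : Set V :=
  (⋃ x ∈ X, G.neighborSet x) \ X

/-- `N_G(X, Y) := N_G(X) ∩ Y`. -/
def nbhdIn {V : Type*} (G : SimpleGraph V) (X Y : Set V) : Set V :=
  nbhd G X ∩ Y

/-- `E_m^n(p)`: the vertices of `Z_m^n` whose coordinate sum is `p` modulo `m`. -/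
def Eclass (m n : ℕ) (p : ZMod m) : Set (Fin n → ZMod m) :=
  {v | ∑ i, v i = p}

/-- A maximum independent set: an independent set of the largest possible cardinality. -/
def MaxIndep {V : Type*} (G : SimpleGraph V) (s : Set V) : Prop :=
  IsIndep G s ∧ ∀ t : Set V, IsIndep G t → t.ncard ≤ s.ncard

open Classical in
/-- Vertices of `X` with no neighbour in `D`. -/
noncomputable def freeIn {V : Type*} (G : SimpleGraph V) (X D : Finset V) : Finset V :=
  X.filter (fun u => ∀ v ∈ D, ¬ G.Adj v u)

open Classical in
lemma freeIn_sub {V : Type*} (G : SimpleGraph V) (X D : Finset V) : freeIn G X D ⊆ X := by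
  unfold freeIn
  exact Finset.filter_subset _ _

open Classical in
lemma freeIn_card {V : Type*} (G : SimpleGraph V) (n : ℕ) (X D : Finset V)
    (h : ∀ v ∈ D, (X.filter (fun u => G.Adj v u)).card ≤ n) :
    X.card ≤ (freeIn G X D).card + D.card * n := by
  have h1 : X ⊆ freeIn G X D ∪ D.biUnion (fun v => X.filter (fun u => G.Adj v u)) := by
    intro u hu
    by_cases hc : ∀ v ∈ D, ¬ G.Adj v u
    · exact Finset.mem_union_left _ (by simp only [freeIn, Finset.mem_filter]; exact ⟨hu, hc⟩)
    · push Not at hc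
      obtain ⟨v, hv, ha⟩ := hc
      refine Finset.mem_union_right _ ?_
      simp only [Finset.mem_biUnion, Finset.mem_filter]
      exact ⟨v, hv, hu, ha⟩
  calc X.card ≤ _ := Finset.card_le_card h1
    _ ≤ _ := Finset.card_union_le _ _
    _ ≤ _ := by
      gcongr
      exact Finset.card_biUnion_le_card_mul _ _ _ h

open Classical in
lemma count_lower {V : Type*} [Fintype V] (G : SimpleGraph V) (n : ℕ)
    (A B I : Finset V)
    (hAB : Disjoint A B) (hAI : Disjoint A I) (hBI : Disjoint B I)
    (iA : ∀ u ∈ A, ∀ v ∈ A, ¬ G.Adj u v)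
    (iB : ∀ u ∈ B, ∀ v ∈ B, ¬ G.Adj u v)
    (iI : ∀ u ∈ I, ∀ v ∈ I, ¬ G.Adj u v)
    (dAB : ∀ v ∈ A, (B.filter (fun u => G.Adj v u)).card ≤ n)
    (dAI : ∀ v ∈ A, (I.filter (fun u => G.Adj v u)).card ≤ n)
    (dBI : ∀ v ∈ B, (I.filter (fun u => G.Adj v u)).card ≤ n)
    (l : ℝ) (hl : l = (1 / 2) ^ n) :
    (2 : ℝ) ^ I.card * ((1 + l) ^ B.card * (1 + l * (1 / (1 + l)) ^ n) ^ A.card) ≤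
      (Nat.card {s : Set V // IsIndep G s} : ℝ) := by
  have l0 : 0 < l := by rw [hl]; positivity
  set T : Finset (Σ _ : Finset V, Σ _ : Finset V, Finset V) :=
    A.powerset.sigma (fun D => (freeIn G B D).powerset.sigma
      (fun D' => (freeIn G I (D ∪ D')).powerset)) with hT
  have hTle : T.card ≤ Nat.card {s : Set V // IsIndep G s} := by
    rw [Nat.card_eq_fintype_card, Fintype.card_subtype]
    refine Finset.card_le_card_of_injOn
      (fun x => ((x.1 ∪ x.2.1 ∪ x.2.2 : Finset V) : Set V)) ?_ ?_
    · rintro ⟨D, D', S⟩ hx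
      simp only [hT, Finset.coe_sigma, Set.mem_sigma_iff, Finset.mem_coe, Finset.mem_powerset] at hx
      obtain ⟨h1, h2, h3⟩ := hx
      simp only [Finset.mem_coe, Finset.mem_filter, Finset.mem_univ, true_and]
      have q2 : ∀ u ∈ D', u ∈ B ∧ ∀ v ∈ D, ¬ G.Adj v u := fun u hu => by
        have := h2 hu
        simpa only [freeIn, Finset.mem_filter] using this
      have q3 : ∀ u ∈ S, u ∈ I ∧ ∀ v ∈ D ∪ D', ¬ G.Adj v u := fun u hu => by
        have := h3 hu
        simpa only [freeIn, Finset.mem_filter] using this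
      intro u hu v hv _ hadj
      have hadj' := hadj.symm
      simp only [Finset.mem_coe, Finset.mem_union] at hu hv q3
      rcases hu with (hu | hu) | hu <;> rcases hv with (hv | hv) | hv
      · exact iA u (h1 hu) v (h1 hv) hadj
      · exact (q2 v hv).2 u hu hadj
      · exact (q3 v hv).2 u (Or.inl hu) hadj
      · exact (q2 u hu).2 v hv hadj'
      · exact iB u (q2 u hu).1 v (q2 v hv).1 hadj
      · exact (q3 v hv).2 u (Or.inr hu) hadj
      · exact (q3 u hu).2 v (Or.inl hv) hadj'
      · exact (q3 u hu).2 v (Or.inr hv) hadj'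
      · exact iI u (q3 u hu).1 v (q3 v hv).1 hadj
    · have key : ∀ x ∈ T, x.1 = (x.1 ∪ x.2.1 ∪ x.2.2) ∩ A ∧ x.2.1 = (x.1 ∪ x.2.1 ∪ x.2.2) ∩ B ∧
          x.2.2 = (x.1 ∪ x.2.1 ∪ x.2.2) ∩ I := by
        rintro ⟨D, D', S⟩ hx
        simp only [hT, Finset.mem_sigma, Finset.mem_powerset] at hx
        obtain ⟨h1, h2, h3⟩ := hx
        replace h2 := h2.trans (freeIn_sub G _ _)
        replace h3 := h3.trans (freeIn_sub G _ _)
        rw [Finset.disjoint_left] at hAB hAI hBI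
        refine ⟨?_, ?_, ?_⟩ <;> ext u <;> simp only [Finset.mem_inter, Finset.mem_union] <;>
          have a1 := @h1 u <;> have a2 := @h2 u <;> have a3 := @h3 u <;>
          have b1 := @hAB u <;> have b2 := @hAI u <;> have b3 := @hBI u <;> tauto
      intro x hx y hy hxy
      have hxy' : x.1 ∪ x.2.1 ∪ x.2.2 = y.1 ∪ y.2.1 ∪ y.2.2 := Finset.coe_injective hxy
      obtain ⟨a1, a2, a3⟩ := key x hx
      obtain ⟨b1, b2, b3⟩ := key y hy
      rw [hxy'] at a1 a2 a3
      have e1 := a1.trans b1.symm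
      have e2 := a2.trans b2.symm
      have e3 := a3.trans b3.symm
      obtain ⟨x1, x2, x3⟩ := x
      obtain ⟨y1, y2, y3⟩ := y
      simp only at e1 e2 e3
      subst e1 e2 e3
      rfl
  refine le_trans ?_ (Nat.cast_le.mpr hTle)
  have bin : ∀ (X : Finset V) (x : ℝ), ∑ D ∈ X.powerset, x ^ D.card = (1 + x) ^ X.card := by
    intro X x
    have := Finset.sum_pow_mul_eq_add_pow x 1 X
    simpa [add_comm] using this
  rw [hT, Finset.card_sigma]
  push_cast
  rw [← bin A, Finset.mul_sum, Finset.mul_sum]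
  refine Finset.sum_le_sum fun D hD => ?_
  rw [Finset.mem_powerset] at hD
  rw [Finset.card_sigma]
  push_cast
  have step : ∀ D' ∈ (freeIn G B D).powerset,
      (2 : ℝ) ^ I.card * l ^ D.card * l ^ D'.card ≤
        ((freeIn G I (D ∪ D')).powerset.card : ℝ) := by
    intro D' hD'
    rw [Finset.mem_powerset] at hD'
    replace hD' := hD'.trans (freeIn_sub G _ _)
    rw [Finset.card_powerset]
    push_cast
    have hc := freeIn_card G n I (D ∪ D') (by
      intro v hv
      rcases Finset.mem_union.1 hv with hv | hv
      · exact dAI v (hD hv)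
      · exact dBI v (hD' hv))
    have hc2 := Finset.card_union_le D D'
    have hc3 : I.card ≤ (freeIn G I (D ∪ D')).card + n * (D.card + D'.card) := by
      nlinarith
    calc (2 : ℝ) ^ I.card * l ^ D.card * l ^ D'.card
        ≤ 2 ^ ((freeIn G I (D ∪ D')).card + n * (D.card + D'.card)) * l ^ D.card * l ^ D'.card := by
          gcongr; norm_num
      _ = 2 ^ (freeIn G I (D ∪ D')).card * (2 ^ n * l) ^ (D.card + D'.card) := by ring
      _ = _ := by
          rw [hl, ← mul_pow]; norm_num
  refine le_trans ?_ (Finset.sum_le_sum step)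
  rw [← Finset.mul_sum, bin]
  have hc := freeIn_card G n B D (fun v hv => dAB v (hD hv))
  calc (2 : ℝ) ^ I.card * ((1 + l) ^ B.card * (l * (1 / (1 + l)) ^ n) ^ D.card)
      ≤ 2 ^ I.card * ((1 + l) ^ ((freeIn G B D).card + D.card * n) *
          (l * (1 / (1 + l)) ^ n) ^ D.card) := by
        gcongr; linarith
    _ = 2 ^ I.card * l ^ D.card * (1 + l) ^ (freeIn G B D).card *
          ((1 + l) * (1 / (1 + l))) ^ (D.card * n) := by
        rw [mul_pow l, mul_pow (1 + l), pow_add, ← pow_mul, mul_comm n]; ring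
    _ = _ := by
        rw [mul_one_div_cancel (by positivity), one_pow, mul_one]
    _ ≤ _ := le_rfl

lemma torus_adj {m n : ℕ} {u v : Fin n → ZMod m} (h : (torus m n).Adj u v) :
    ∃ j : Fin n, ∃ e : ZMod m, (e = 1 ∨ e = -1) ∧ v = Function.update u j (u j + e) ∧
      ∑ i, v i = ∑ i, u i + e := by
  have main : ∃ j : Fin n, ∃ e : ZMod m, (e = 1 ∨ e = -1) ∧ v = Function.update u j (u j + e) := by
    rw [torus, SimpleGraph.fromRel_adj] at h
    have mk : ∀ (j : Fin n) (e : ZMod m), v j = u j + e → (∀ i, i ≠ j → v i = u i) →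
        v = Function.update u j (u j + e) := by
      intro j e h1 h2
      ext i
      by_cases hi : i = j
      · subst hi; simpa using h1
      · simp [hi, h2 i hi]
    rcases h.2 with ⟨j, h1, h2⟩ | ⟨j, h1, h2⟩
    · rcases h1 with h1 | h1
      · exact ⟨j, -1, Or.inr rfl, mk j _ (by rw [h1]; ring) (fun i hi => (h2 i hi).symm)⟩
      · exact ⟨j, 1, Or.inl rfl, mk j _ (by rw [h1]; ring) (fun i hi => (h2 i hi).symm)⟩
    · rcases h1 with h1 | h1
      · exact ⟨j, 1, Or.inl rfl, mk j _ h1 h2⟩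
      · exact ⟨j, -1, Or.inr rfl, mk j _ (by rw [h1]; ring) h2⟩
  obtain ⟨j, e, he, hv⟩ := main
  refine ⟨j, e, he, hv, ?_⟩
  rw [hv, Finset.sum_update_of_mem (Finset.mem_univ j),
    ← Finset.add_sum_erase _ _ (Finset.mem_univ j), Finset.sdiff_singleton_eq_erase]
  ring

open Classical in
lemma deg_le {m n : ℕ} (v : Fin n → ZMod m) (X : Finset (Fin n → ZMod m)) (e : ZMod m)
    (h : ∀ u ∈ X, (torus m n).Adj v u → ∑ i, u i = ∑ i, v i + e) :
    (X.filter (fun u => (torus m n).Adj v u)).card ≤ n := by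
  have : X.filter (fun u => (torus m n).Adj v u) ⊆
      Finset.univ.image (fun j : Fin n => Function.update v j (v j + e)) := by
    intro u hu
    rw [Finset.mem_filter] at hu
    obtain ⟨j, e', -, hv, hs⟩ := torus_adj hu.2
    have := h u hu.1 hu.2
    have he : e' = e := add_left_cancel (hs.symm.trans this)
    subst he
    exact Finset.mem_image.2 ⟨j, Finset.mem_univ _, hv.symm⟩
  calc _ ≤ _ := Finset.card_le_card this
    _ ≤ _ := Finset.card_image_le
    _ = n := by simp

open Classical in
lemma class_card (m k : ℕ) [NeZero m] (P : Finset (ZMod m)) :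
    (Finset.univ.filter (fun v : Fin (k + 1) → ZMod m => ∑ i, v i ∈ P)).card =
      P.card * m ^ k := by
  have : (P ×ˢ (Finset.univ : Finset (Fin k → ZMod m))).card = P.card * m ^ k := by
    rw [Finset.card_product]; simp [ZMod.card]
  rw [← this]
  refine Finset.card_bij' (fun v _ => (∑ i, v i, Fin.tail v))
    (fun x _ => Fin.cons (x.1 - ∑ i, x.2 i) x.2) ?_ ?_ ?_ ?_
  · intro v hv
    simpa using hv
  · rintro ⟨p, w⟩ hw
    simpa [Fin.sum_univ_succ] using hw
  · intro v hv
    refine Eq.trans ?_ (Fin.cons_self_tail v)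
    congr 1
    simp [Fin.sum_univ_succ, Fin.tail]
  · rintro ⟨p, w⟩ hw
    simp [Fin.sum_univ_succ]

lemma analytic (n : ℕ) (l c : ℝ) (l0 : 0 < l) (l1 : l ≤ 1) (h : (n + 1) * l ≤ c) :
    Real.exp ((1 - c) * l) ≤ 1 + l * (1 / (1 + l)) ^ n := by
  set μ := l * (1 / (1 + l)) ^ n with hμ
  have μ0 : 0 < μ := by positivity
  have q1 : 1 / (1 + l) ≤ 1 := by rw [div_le_one (by positivity)]; linarith
  have μl : μ ≤ l := by
    have : (1 / (1 + l)) ^ n ≤ 1 := pow_le_one₀ (by positivity) q1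
    nlinarith
  have hB : 1 - (n + 1) * l ≤ (1 / (1 + l)) ^ (n + 1) := by
    have h1 := one_add_mul_le_pow (a := -l) (by linarith) (n + 1)
    have h2 : 1 - l ≤ 1 / (1 + l) := by
      rw [le_div_iff₀ (by positivity)]; nlinarith
    have h3 : (1 + -l) ^ (n + 1) ≤ (1 / (1 + l)) ^ (n + 1) :=
      pow_le_pow_left₀ (by linarith) (by linarith) _
    push_cast at h1
    linarith
  have h4 : (1 - c) * l ≤ μ / (1 + μ) := by
    calc (1 - c) * l ≤ (1 / (1 + l)) ^ (n + 1) * l := by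
          apply mul_le_mul_of_nonneg_right _ l0.le; linarith
      _ = μ / (1 + l) := by rw [hμ, pow_succ]; ring
      _ ≤ μ / (1 + μ) := by gcongr
  have h5 := Real.one_sub_inv_le_log_of_pos (show 0 < 1 + μ by positivity)
  have h6 : μ / (1 + μ) = 1 - (1 + μ)⁻¹ := by field_simp; ring
  rw [← Real.le_log_iff_exp_le (by positivity)]
  linarith

/-- There are at least `2^(⌊m/2⌋·m^(n-1)) · exp((1-o(1))·(m/2)^(n-1))`
independent sets in `Z_m^n` for `m ≥ 3` odd. -/
theorem stmt_1 (m : ℕ) (hm : 3 ≤ m) (hmo : Odd m) (ε : ℝ) (hε : 0 < ε) :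
    ∃ n₀ : ℕ, ∀ n : ℕ, n₀ ≤ n →
      (2 : ℝ) ^ (m / 2 * m ^ (n - 1)) * Real.exp ((1 - ε) * ((m : ℝ) / 2) ^ (n - 1)) ≤
        (Nat.card {s : Set (Fin n → ZMod m) // IsIndep (torus m n) s} : ℝ) := by
  classical
  haveI : NeZero m := ⟨by omega⟩
  have hlim : Filter.Tendsto (fun n : ℕ => ((n : ℝ) + 1) * (1 / 2) ^ n) Filter.atTop (nhds 0) := by
    have h1 := tendsto_self_mul_const_pow_of_lt_one (r := (1 / 2 : ℝ)) (by norm_num) (by norm_num)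
    have h2 := tendsto_pow_atTop_nhds_zero_of_lt_one (r := (1 / 2 : ℝ)) (by norm_num) (by norm_num)
    have := h1.add h2
    simp only [add_zero] at this
    refine this.congr fun n => by ring
  obtain ⟨n₀, hn₀⟩ := Filter.eventually_atTop.1 (hlim.eventually (ge_mem_nhds hε))
  refine ⟨n₀ + 1, fun n hn => ?_⟩
  have hs := hn₀ n (by omega)
  obtain ⟨k, rfl⟩ : ∃ k, n = k + 1 := ⟨n - 1, by omega⟩
  rw [Nat.add_sub_cancel]
  obtain ⟨h, rfl⟩ := hmo
  have hdiv : (2 * h + 1) / 2 = h := by omega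
  rw [hdiv]
  set m := 2 * h + 1 with hmdef
  -- natural number casts
  have cast_inj : ∀ a b : ℕ, a < m → b < m → (a : ZMod m) = b → a = b := by
    intro a b ha hb hab
    have := congrArg ZMod.val hab
    rwa [ZMod.val_natCast_of_lt ha, ZMod.val_natCast_of_lt hb] at this
  have one_ne : (1 : ZMod m) ≠ 0 := by
    intro hh
    have := cast_inj 1 0 (by omega) (by omega) (by simpa using hh)
    omega
  have two_ne : (1 : ZMod m) + 1 ≠ 0 := by
    intro hh
    have := cast_inj 2 0 (by omega) (by omega) (by push_cast; rw [← hh]; ring)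
    omega
  set P : Finset (ZMod m) := (Finset.range h).image (fun j : ℕ => ((2 * j + 1 : ℕ) : ZMod m)) with hP
  have Pcard : P.card = h := by
    rw [hP, Finset.card_image_of_injOn, Finset.card_range]
    intro a ha b hb hab
    simp only [Finset.coe_range, Set.mem_Iio] at ha hb
    have := cast_inj _ _ (by omega) (by omega) hab
    omega
  have P0 : (0 : ZMod m) ∉ P := by
    intro hh
    obtain ⟨j, hj, e⟩ := Finset.mem_image.1 hh
    rw [Finset.mem_range] at hj
    have := cast_inj (2 * j + 1) 0 (by omega) (by omega) (by rw [e]; simp)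
    omega
  have P1 : (-1 : ZMod m) ∉ P := by
    intro hh
    obtain ⟨j, hj, e⟩ := Finset.mem_image.1 hh
    rw [Finset.mem_range] at hj
    have := cast_inj (2 * j + 1 + 1) 0 (by omega) (by omega) (by
      rw [Nat.cast_add, e]; simp)
    omega
  have Psucc : ∀ p ∈ P, p + 1 ∉ P := by
    intro p hp hh
    obtain ⟨j, hj, e⟩ := Finset.mem_image.1 hh
    obtain ⟨i, hi, e'⟩ := Finset.mem_image.1 hp
    rw [Finset.mem_range] at hi hj
    have := cast_inj (2 * i + 1 + 1) (2 * j + 1) (by omega) (by omega) (by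
      rw [Nat.cast_add, e, e']; simp)
    omega
  let C : Finset (ZMod m) → Finset (Fin (k + 1) → ZMod m) := fun Q =>
    Finset.univ.filter (fun v => ∑ i, v i ∈ Q)
  have memC : ∀ Q v, v ∈ C Q ↔ ∑ i, v i ∈ Q := by intro Q v; simp [C]
  have disj : ∀ Q R : Finset (ZMod m), Disjoint Q R → Disjoint (C Q) (C R) := by
    intro Q R hQR
    rw [Finset.disjoint_left] at hQR ⊢
    intro v hv hv'
    exact hQR ((memC _ _).1 hv) ((memC _ _).1 hv')
  have ind : ∀ Q : Finset (ZMod m), (∀ p ∈ Q, p + 1 ∉ Q) →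
      ∀ u ∈ C Q, ∀ v ∈ C Q, ¬ (torus m (k + 1)).Adj u v := by
    intro Q hQ u hu v hv hadj
    rw [memC] at hu hv
    obtain ⟨j, e, he, -, hs⟩ := torus_adj hadj
    rcases he with rfl | rfl
    · rw [hs] at hv; exact hQ _ hu hv
    · apply hQ _ hv
      rw [hs]; simpa using hu
  have cnt := count_lower (torus m (k + 1)) (k + 1) (C {0}) (C {-1}) (C P)
    (disj _ _ (by simpa using one_ne)) (disj _ _ (by simpa using P0))
    (disj _ _ (by simpa using P1))
    (ind _ (by simpa using one_ne)) (ind _ (by simpa using one_ne)) (ind _ Psucc)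
    (by
      intro v hv
      refine deg_le v _ (-1) ?_
      intro u hu _
      rw [memC, Finset.mem_singleton] at hu hv
      rw [hu, hv]; simp)
    (by
      intro v hv
      refine deg_le v _ 1 ?_
      intro u hu hadj
      rw [memC] at hu hv
      rw [Finset.mem_singleton] at hv
      obtain ⟨j, e, he, -, hs⟩ := torus_adj hadj
      rcases he with rfl | rfl
      · exact hs
      · rw [hs, hv, zero_add] at hu; exact absurd hu P1)
    (by
      intro v hv
      refine deg_le v _ (-1) ?_
      intro u hu hadj
      rw [memC] at hu hv
      rw [Finset.mem_singleton] at hv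
      obtain ⟨j, e, he, -, hs⟩ := torus_adj hadj
      rcases he with rfl | rfl
      · rw [hs, hv, neg_add_cancel] at hu; exact absurd hu P0
      · exact hs)
    _ rfl
  refine le_trans ?_ cnt
  have cardC : ∀ Q, (C Q).card = Q.card * m ^ k := fun Q => class_card m k Q
  rw [cardC, cardC, cardC, Pcard, Finset.card_singleton, Finset.card_singleton, one_mul]
  refine mul_le_mul_of_nonneg_left ?_ (by positivity)
  set l : ℝ := (1 / 2) ^ (k + 1) with hl
  have l0 : 0 < l := by positivity
  have l1 : l ≤ 1 := pow_le_one₀ (by norm_num) (by norm_num)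
  have ha := analytic (k + 1) l ε l0 l1 hs
  have q1 : (1 / (1 + l)) ^ (k + 1) ≤ 1 :=
    pow_le_one₀ (by positivity) (by rw [div_le_one (by positivity)]; linarith)
  have hle : 1 + l * (1 / (1 + l)) ^ (k + 1) ≤ 1 + l := by nlinarith
  have hexp : Real.exp ((1 - ε) * ((m : ℝ) / 2) ^ k) =
      Real.exp ((1 - ε) * l) ^ (m ^ k) * Real.exp ((1 - ε) * l) ^ (m ^ k) := by
    rw [← Real.exp_nat_mul, ← Real.exp_add]
    congr 1
    rw [hl, div_pow, pow_succ]
    push_cast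
    simp only [one_div, inv_pow]
    ring
  rw [hexp]
  gcongr
  exact ha.trans hle
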